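/- Let E=(C,V,k,B) be an election and let W ∈ F be a feasible outcome maximizing the PAV score ∑_{i∈V} H(|W ∩ (A_i ∪ ¬D_i)|) over all feasible outcomes. Then for every nonempty group of voters S ⊆ V and every positive integer ℓ such that S is ℓ-cohesive, the average satisfaction of S satisfies avgsat_S(W) ≥ (1 − 2/(k+4))·ℓ − 3/2. -/

import Mathlib

open Finset

variable {C V : Type*}

/-- The set of (virtual) positive copies of a set of candidates. -/
def posOf [DecidableEq C] (X : Finset C) : Finset (C ⊕ C) := X.image Sum.inl

/-- The set of virtual negative counterparts `¬c` of a set of candidates. -/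
def negOf [DecidableEq C] (X : Finset C) : Finset (C ⊕ C) := X.image Sum.inr

/-- The positive part `W ∩ C` of an outcome `W ⊆ C ∪ ¬C`. -/
def posPart [Fintype C] [DecidableEq C] (W : Finset (C ⊕ C)) : Finset C :=
  univ.filter (fun c => Sum.inl c ∈ W)

/-- Feasibility: at most `k` positive candidates, and never both `c` and `¬c`. -/
def Feasible [Fintype C] [DecidableEq C] (k : ℕ) (W : Finset (C ⊕ C)) : Prop :=
  (posPart W).card ≤ k ∧ ∀ c : C, ¬ (Sum.inl c ∈ W ∧ Sum.inr c ∈ W)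

/-- Common intersection `⋂_{i ∈ S} F i` (e.g. `A_S` or `D_S`). -/
def comInt [Fintype C] [DecidableEq C] (F : V → Finset C) (S : Finset V) : Finset C :=
  univ.filter (fun c => ∀ i ∈ S, c ∈ F i)

/-- Utility of voter `i` in the symmetric model: `|A_i ∩ W| + |¬D_i ∩ W|`. -/
def util [DecidableEq C] (A D : V → Finset C) (i : V) (W : Finset (C ⊕ C)) : ℕ :=
  ((posOf (A i) ∪ negOf (D i)) ∩ W).card

/-- `ℓ`-cohesiveness of a group `S` in the symmetric model. -/
def Cohesive [Fintype C] [DecidableEq C] [Fintype V] (A D : V → Finset C)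
    (k ℓ : ℕ) (S : Finset V) : Prop :=
  ∀ T : Finset (C ⊕ C), Feasible k T →
    (∃ X ⊆ posOf (comInt A S) ∪ negOf (comInt D S), ℓ ≤ X.card ∧ Feasible k (T ∪ X)) ∨
    (ℓ : ℚ) / ((T.card : ℚ) + (ℓ : ℚ)) < (S.card : ℚ) / (Fintype.card V : ℚ)

/-- The closed formula `claim(S)`, given `n = |V|`, `m = |C|`, `k`, `s = |S|`,
`aS = |A_S|`, `dS = |D_S|`. -/
def claimQ (n m k s aS dS : ℕ) : ℚ :=
  if (n : ℚ) / ((n : ℚ) - (s : ℚ)) * k ≤ (dS : ℚ) then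
    (dS : ℚ) - (k : ℚ)
  else if ((n : ℚ) - (s : ℚ)) / n * k ≤ (dS : ℚ) ∧
      (dS : ℚ) ≤ (n : ℚ) / ((n : ℚ) - (s : ℚ)) * k ∧
      (k : ℚ) ≤ (2 * (n : ℚ) - (s : ℚ)) / n * aS + ((n : ℚ) - (s : ℚ)) / n * dS then
    (s : ℚ) / (2 * (n : ℚ) - (s : ℚ)) * ((dS : ℚ) + (k : ℚ))
  else if (k : ℚ) ≤ (aS : ℚ) + (dS : ℚ) ∧ (dS : ℚ) ≤ ((n : ℚ) - (s : ℚ)) / n * k ∧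
      (aS : ℚ) ≤ (m : ℚ) - ((n : ℚ) - (s : ℚ)) / n * k then
    (s : ℚ) / n * k
  else if (k : ℚ) ≤ (aS : ℚ) + (dS : ℚ) ∧ (dS : ℚ) ≤ ((n : ℚ) - (s : ℚ)) / n * k ∧
      (m : ℚ) - ((n : ℚ) - (s : ℚ)) / n * k ≤ (aS : ℚ) ∧
      (aS : ℚ) + (k : ℚ) - (m : ℚ) ≤ (s : ℚ) / n * ((aS : ℚ) + (dS : ℚ)) then
    (aS : ℚ) + (k : ℚ) - (m : ℚ)
  else
    (s : ℚ) / n * ((aS : ℚ) + (dS : ℚ))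

/-- The harmonic number `H(x) = ∑_{j=1}^x 1/j`. -/
def harm (x : ℕ) : ℚ := ∑ j ∈ Finset.range x, 1 / ((j : ℚ) + 1)


theorem harm_succ (n : ℕ) : harm (n + 1) = harm n + 1 / ((n : ℚ) + 1) := by
  simp [harm, Finset.sum_range_succ]

theorem harm_mono {m n : ℕ} (h : m ≤ n) : harm m ≤ harm n := by
  induction n, h using Nat.le_induction with
  | base => exact le_rfl
  | succ n _ ih =>
    rw [harm_succ]
    have : (0 : ℚ) ≤ 1 / ((n : ℚ) + 1) := by positivity
    linarith

/-- The indicator of `y ∈ U`, as a rational number. -/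
def ind {α : Type*} [DecidableEq α] (U : Finset α) (y : α) : ℚ := if y ∈ U then 1 else 0

section Swap

variable {α : Type*} [DecidableEq α]

theorem sum_ind (U T : Finset α) : ∑ y ∈ T, ind U y = ((U ∩ T).card : ℚ) := by
  unfold ind
  rw [sum_boole, filter_mem_eq_inter, inter_comm]

theorem card_swap (U W Z Y : Finset α) (hY : Y ⊆ U) (hYW : Disjoint Y W) :
    (U ∩ W).card + Y.card ≤ (U ∩ (W \ Z ∪ Y)).card + (U ∩ Z).card := by
  have h1 : (U ∩ W).card ≤ (U ∩ (W \ Z)).card + (U ∩ Z).card := by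
    refine le_trans (card_le_card ?_) (card_union_le _ _)
    intro x; simp only [mem_inter, mem_union, mem_sdiff]; tauto
  have h2 : (U ∩ (W \ Z)).card + Y.card ≤ (U ∩ (W \ Z ∪ Y)).card := by
    rw [← card_union_of_disjoint]
    · refine card_le_card ?_
      intro x; simp only [mem_inter, mem_union, mem_sdiff]
      have := @hY x; tauto
    · refine (hYW.symm).mono_left ?_
      intro x; simp only [mem_inter, mem_sdiff]; tauto
  omega

theorem card_le_card_swap_add (U W Z Y : Finset α) :
    (U ∩ W).card ≤ (U ∩ (W \ Z ∪ Y)).card + (U ∩ Z).card := by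
  refine le_trans (card_le_card ?_) (card_union_le _ _)
  intro x; simp only [mem_inter, mem_union, mem_sdiff]; tauto

theorem harm_sub_le_one (U W W' : Finset α) (y : α) (hy : y ∈ W)
    (h : (U ∩ W).card ≤ (U ∩ W').card + (U ∩ {y}).card) :
    harm (U ∩ W).card - harm (U ∩ W').card ≤ ind U y / ((U ∩ W).card : ℚ) := by
  by_cases hyU : y ∈ U
  · rw [inter_singleton_of_mem hyU, card_singleton] at h
    have hpos : 0 < (U ∩ W).card := card_pos.2 ⟨y, mem_inter.2 ⟨hyU, hy⟩⟩
    obtain ⟨p, hp⟩ : ∃ p, (U ∩ W).card = p + 1 := ⟨_, (Nat.succ_pred_eq_of_pos hpos).symm⟩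
    rw [hp] at h ⊢
    have := harm_mono (show p ≤ (U ∩ W').card by omega)
    rw [harm_succ]
    simp only [ind, hyU, if_true]
    push_cast
    linarith
  · rw [inter_singleton_of_notMem hyU, card_empty] at h
    have := harm_mono (show (U ∩ W).card ≤ (U ∩ W').card by omega)
    simp only [ind, hyU, if_false, zero_div]
    linarith

theorem harm_sub_le_two (U W W' : Finset α) (y z : α) (hy : y ∈ W) (hz : z ∈ W) (hyz : y ≠ z)
    (h : (U ∩ W).card ≤ (U ∩ W').card + (U ∩ {y, z}).card) :
    harm (U ∩ W).card - harm (U ∩ W').card ≤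
      (ind U y + ind U z) / ((U ∩ W).card : ℚ) +
        ind U y * ind U z / (((U ∩ W).card : ℚ) * (((U ∩ W).card : ℚ) - 1)) := by
  by_cases hyU : y ∈ U
  · by_cases hzU : z ∈ U
    · have h2 : (U ∩ {y, z}).card = 2 := by
        rw [inter_eq_right.2 (by intro x; simp only [mem_insert, mem_singleton]
                                 rintro (rfl | rfl) <;> assumption), card_pair hyz]
      have hpos : 2 ≤ (U ∩ W).card := by
        rw [← card_pair hyz]
        refine card_le_card ?_
        intro x; simp only [mem_insert, mem_singleton, mem_inter]
        rintro (rfl | rfl) <;> exact ⟨by assumption, by assumption⟩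
      rw [h2] at h
      obtain ⟨p, hp⟩ : ∃ p, (U ∩ W).card = p + 1 + 1 := ⟨(U ∩ W).card - 2, by omega⟩
      rw [hp] at h ⊢
      have := harm_mono (show p ≤ (U ∩ W').card by omega)
      rw [harm_succ, harm_succ]
      simp only [ind, hyU, hzU, if_true]
      push_cast
      have key : (1 + 1 : ℚ) / ((p : ℚ) + 1 + 1) + 1 * 1 / (((p : ℚ) + 1 + 1) * ((p : ℚ) + 1 + 1 - 1))
          = 1 / ((p : ℚ) + 1) + 1 / ((p : ℚ) + 1 + 1) := by
        rw [add_sub_cancel_right]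
        field_simp
        ring
      rw [key]
      linarith
    · have h2 : U ∩ {y, z} = U ∩ {y} := by grind
      rw [h2] at h
      have := harm_sub_le_one U W W' y hy h
      have hz0 : ind U z = 0 := by simp [ind, hzU]
      simpa [hz0] using this
  · have h2 : U ∩ {y, z} = U ∩ {z} := by grind
    rw [h2] at h
    have := harm_sub_le_one U W W' z hz h
    have hz0 : ind U y = 0 := by simp [ind, hyU]
    simpa [hz0] using this

theorem le_harm_sub_one (U W W' : Finset α) (y : α)
    (h : (U ∩ W).card + 1 ≤ (U ∩ W').card + (U ∩ {y}).card) :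
    (1 - ind U y) / (((U ∩ W).card : ℚ) + 1) ≤ harm (U ∩ W').card - harm (U ∩ W).card := by
  by_cases hyU : y ∈ U
  · rw [inter_singleton_of_mem hyU, card_singleton] at h
    have := harm_mono (show (U ∩ W).card ≤ (U ∩ W').card by omega)
    simp only [ind, hyU, if_true, sub_self, zero_div]
    linarith
  · rw [inter_singleton_of_notMem hyU, card_empty] at h
    have := harm_mono (show (U ∩ W).card + 1 ≤ (U ∩ W').card by omega)
    rw [harm_succ] at this
    simp only [ind, hyU, if_false, sub_zero]
    linarith

variable [Fintype V] [DecidableEq V]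

theorem sum_gain_le_sum_loss (u u' : V → ℕ) (S : Finset V) (f g : V → ℚ)
    (hopt : ∑ i, harm (u' i) ≤ ∑ i, harm (u i))
    (hf : ∀ i ∈ S, f i ≤ harm (u' i) - harm (u i))
    (hg : ∀ i ∈ Sᶜ, harm (u i) - harm (u' i) ≤ g i) :
    ∑ i ∈ S, f i ≤ ∑ i ∈ Sᶜ, g i := by
  have h1 := sum_le_sum hf
  have h2 := sum_le_sum hg
  rw [sum_sub_distrib] at h1 h2
  rw [← sum_add_sum_compl S, ← sum_add_sum_compl S (fun i => harm (u i))] at hopt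
  linarith

variable (U : V → Finset α) (W : Finset α) (S : Finset V)

theorem single_swap {x y : α} (hx : x ∉ W) (hy : y ∈ W) (hxS : ∀ i ∈ S, x ∈ U i)
    (hopt : ∑ i, harm (U i ∩ (W \ {y} ∪ {x})).card ≤ ∑ i, harm (U i ∩ W).card) :
    ∑ i ∈ S, (1 - ind (U i) y) / (((U i ∩ W).card : ℚ) + 1) ≤
      ∑ i ∈ Sᶜ, ind (U i) y / ((U i ∩ W).card : ℚ) := by
  refine sum_gain_le_sum_loss _ _ S _ _ hopt (fun i hi => ?_) (fun i _ => ?_)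
  · apply le_harm_sub_one
    simpa using card_swap (U i) W {y} {x} (by simpa using hxS i hi) (by simpa using hx)
  · exact harm_sub_le_one _ _ _ _ hy (card_le_card_swap_add _ _ _ _)

theorem double_removal_swap {x y z : α} (hx : x ∉ W) (hy : y ∈ W) (hz : z ∈ W) (hyz : y ≠ z)
    (hxS : ∀ i ∈ S, x ∈ U i) (hzS : ∀ i ∈ S, z ∉ U i)
    (hopt : ∑ i, harm (U i ∩ (W \ {y, z} ∪ {x})).card ≤ ∑ i, harm (U i ∩ W).card) :
    ∑ i ∈ S, (1 - ind (U i) y) / (((U i ∩ W).card : ℚ) + 1) ≤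
      ∑ i ∈ Sᶜ, ((ind (U i) y + ind (U i) z) / ((U i ∩ W).card : ℚ) +
        ind (U i) y * ind (U i) z / (((U i ∩ W).card : ℚ) * (((U i ∩ W).card : ℚ) - 1))) := by
  refine sum_gain_le_sum_loss _ _ S _ _ hopt (fun i hi => ?_) (fun i _ => ?_)
  · apply le_harm_sub_one
    have h := card_swap (U i) W {y, z} {x} (by simpa using hxS i hi) (by simpa using hx)
    have h2 : U i ∩ {y, z} = U i ∩ {y} := by
      have := hzS i hi
      grind
    rwa [h2, card_singleton] at h
  · exact harm_sub_le_two _ _ _ _ _ hy hz hyz (card_le_card_swap_add _ _ _ _)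

theorem double_swap {x x' y z : α} (hx : x ∉ W) (hx' : x' ∉ W) (hxx' : x ≠ x')
    (hy : y ∈ W) (hz : z ∈ W) (hyz : y ≠ z)
    (hxS : ∀ i ∈ S, x ∈ U i) (hxS' : ∀ i ∈ S, x' ∈ U i)
    (hyS : ∀ i ∈ S, y ∉ U i) (hzS : ∀ i ∈ S, z ∉ U i)
    (hopt : ∑ i, harm (U i ∩ (W \ {y, z} ∪ {x, x'})).card ≤ ∑ i, harm (U i ∩ W).card) :
    ∑ i ∈ S, (1 / (((U i ∩ W).card : ℚ) + 1) + 1 / (((U i ∩ W).card : ℚ) + 2)) ≤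
      ∑ i ∈ Sᶜ, ((ind (U i) y + ind (U i) z) / ((U i ∩ W).card : ℚ) +
        ind (U i) y * ind (U i) z / (((U i ∩ W).card : ℚ) * (((U i ∩ W).card : ℚ) - 1))) := by
  refine sum_gain_le_sum_loss _ _ S _ _ hopt (fun i hi => ?_) (fun i _ => ?_)
  · have h := card_swap (U i) W {y, z} {x, x'}
      (by have := hxS i hi; have := hxS' i hi; grind) (by simp [hx, hx'])
    have h2 : U i ∩ {y, z} = ∅ := by
      have := hzS i hi
      have := hyS i hi
      grind
    rw [h2, card_empty, card_pair hxx'] at h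
    have := harm_mono (show (U i ∩ W).card + 1 + 1 ≤ (U i ∩ (W \ {y, z} ∪ {x, x'})).card by omega)
    rw [harm_succ, harm_succ] at this
    push_cast at this
    have e : ((U i ∩ W).card : ℚ) + 1 + 1 = ((U i ∩ W).card : ℚ) + 2 := by ring
    rw [e] at this
    linarith
  · exact harm_sub_le_two _ _ _ _ _ hy hz hyz (card_le_card_swap_add _ _ _ _)

theorem sum_single_swap {T : Finset α} (hT : T ⊆ W)
    (h : ∀ y ∈ T, ∑ i ∈ S, (1 - ind (U i) y) / (((U i ∩ W).card : ℚ) + 1) ≤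
      ∑ i ∈ Sᶜ, ind (U i) y / ((U i ∩ W).card : ℚ)) :
    ∑ i ∈ S, ((T.card : ℚ) - ((U i ∩ T).card : ℚ)) / (((U i ∩ W).card : ℚ) + 1) ≤
      (Sᶜ.card : ℚ) := by
  have h1 := sum_le_sum h
  rw [sum_comm, sum_comm (s := T)] at h1
  simp only [← sum_div, sum_sub_distrib, sum_ind, sum_const, nsmul_eq_mul, mul_one] at h1
  refine h1.trans ?_
  rw [card_eq_sum_ones, Nat.cast_sum]
  refine sum_le_sum fun i _ => ?_
  rw [Nat.cast_one]
  refine div_le_one_of_le₀ ?_ (by positivity)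
  exact_mod_cast card_le_card (inter_subset_inter_left hT)

theorem sum_double_swap {Δ Q M : Finset α} (hΔ : Δ ⊆ W) (hQ : Q ⊆ W) (hM : M ⊆ W)
    (hΔQ : Disjoint Δ Q) (hΔM : Disjoint Δ M) (hQM : Disjoint Q M) (hQMc : Q.card = M.card)
    (h1 : ∀ y ∈ Δ, ∑ i ∈ S, 1 / (((U i ∩ W).card : ℚ) + 1) ≤
      ∑ i ∈ Sᶜ, ind (U i) y / ((U i ∩ W).card : ℚ))
    (h2 : ∀ z ∈ M, ∀ y ∈ Q, ∑ i ∈ S, (1 - ind (U i) y) / (((U i ∩ W).card : ℚ) + 1) ≤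
      ∑ i ∈ Sᶜ, ((ind (U i) y + ind (U i) z) / ((U i ∩ W).card : ℚ) +
        ind (U i) y * ind (U i) z / (((U i ∩ W).card : ℚ) * (((U i ∩ W).card : ℚ) - 1))))
    (h3 : ∀ z ∈ M, ∀ y ∈ Δ,
      ∑ i ∈ S, (1 / (((U i ∩ W).card : ℚ) + 1) + 1 / (((U i ∩ W).card : ℚ) + 2)) ≤
      ∑ i ∈ Sᶜ, ((ind (U i) y + ind (U i) z) / ((U i ∩ W).card : ℚ) +
        ind (U i) y * ind (U i) z / (((U i ∩ W).card : ℚ) * (((U i ∩ W).card : ℚ) - 1)))) :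
    ∑ i ∈ S, ((Q.card : ℚ) * ((Q.card : ℚ) - ((U i ∩ Q).card : ℚ)) / (((U i ∩ W).card : ℚ) + 1)
      + (Q.card : ℚ) * (Δ.card : ℚ) *
        (1 / (((U i ∩ W).card : ℚ) + 1) + 1 / (((U i ∩ W).card : ℚ) + 2))
      + (Δ.card : ℚ) * (Δ.card : ℚ) * (1 / (((U i ∩ W).card : ℚ) + 1))) ≤
      (Sᶜ.card : ℚ) * ((Q.card : ℚ) + (Δ.card : ℚ) + 1 / 2) := by
  have e1 := mul_le_mul_of_nonneg_left (sum_le_sum h1) (Nat.cast_nonneg (α := ℚ) Δ.card)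
  have e2 := sum_le_sum fun z hz => sum_le_sum (h2 z hz)
  have e3 := sum_le_sum fun z hz => sum_le_sum (h3 z hz)
  have E := add_le_add (add_le_add e2 e3) e1
  have eL : ∑ i ∈ S, ((Q.card : ℚ) * ((Q.card : ℚ) - ((U i ∩ Q).card : ℚ)) /
        (((U i ∩ W).card : ℚ) + 1)
      + (Q.card : ℚ) * (Δ.card : ℚ) *
        (1 / (((U i ∩ W).card : ℚ) + 1) + 1 / (((U i ∩ W).card : ℚ) + 2))
      + (Δ.card : ℚ) * (Δ.card : ℚ) * (1 / (((U i ∩ W).card : ℚ) + 1))) =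
      ∑ z ∈ M, ∑ y ∈ Q, ∑ i ∈ S, (1 - ind (U i) y) / (((U i ∩ W).card : ℚ) + 1) +
      ∑ z ∈ M, ∑ y ∈ Δ,
        ∑ i ∈ S, (1 / (((U i ∩ W).card : ℚ) + 1) + 1 / (((U i ∩ W).card : ℚ) + 2)) +
      (Δ.card : ℚ) * ∑ y ∈ Δ, ∑ i ∈ S, 1 / (((U i ∩ W).card : ℚ) + 1) := by
    rw [sum_add_distrib, sum_add_distrib]
    congr 1
    · congr 1
      · simp only [sum_const, nsmul_eq_mul]
        rw [sum_comm, mul_sum, hQMc]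
        refine sum_congr rfl fun i _ => ?_
        rw [← sum_div, sum_sub_distrib, sum_ind]
        simp only [sum_const, nsmul_eq_mul, hQMc]
        ring
      · simp only [sum_const, nsmul_eq_mul]
        rw [← mul_sum, hQMc]
        ring
    · simp only [sum_const, nsmul_eq_mul]
      rw [← mul_sum]
      ring
  rw [eL]
  refine E.trans ?_
  have comm2 : ∀ (B : Finset α) (F : α → α → V → ℚ), ∑ z ∈ M, ∑ y ∈ B, ∑ i ∈ Sᶜ, F z y i =
      ∑ i ∈ Sᶜ, ∑ z ∈ M, ∑ y ∈ B, F z y i := by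
    intro B F
    rw [sum_comm]
    rw [sum_congr rfl fun y _ => sum_comm (s := M), sum_comm]
    exact sum_congr rfl fun i _ => sum_comm
  rw [comm2, comm2, sum_comm (s := Δ), mul_sum, ← sum_add_distrib, ← sum_add_distrib,
    ← nsmul_eq_mul]
  refine sum_le_card_nsmul _ _ _ fun i _ => ?_
  have inner : ∀ B : Finset α, ∑ z ∈ M, ∑ y ∈ B,
      ((ind (U i) y + ind (U i) z) / ((U i ∩ W).card : ℚ) +
        ind (U i) y * ind (U i) z / (((U i ∩ W).card : ℚ) * (((U i ∩ W).card : ℚ) - 1))) =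
      ((M.card : ℚ) * ((U i ∩ B).card : ℚ) + (B.card : ℚ) * ((U i ∩ M).card : ℚ)) /
        ((U i ∩ W).card : ℚ) +
      ((U i ∩ B).card : ℚ) * ((U i ∩ M).card : ℚ) /
        (((U i ∩ W).card : ℚ) * (((U i ∩ W).card : ℚ) - 1)) := by
    intro B
    simp only [sum_add_distrib, ← sum_div, ← sum_mul, ← mul_sum, sum_ind, sum_const, nsmul_eq_mul]
  rw [inner, inner, ← sum_div, sum_ind, ← hQMc]
  have hcard : (U i ∩ Δ).card + (U i ∩ Q).card + (U i ∩ M).card ≤ (U i ∩ W).card := by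
    rw [← card_union_of_disjoint, ← card_union_of_disjoint]
    · refine card_le_card ?_
      grind
    · rw [disjoint_union_left]
      exact ⟨hΔM.mono inter_subset_right inter_subset_right,
        hQM.mono inter_subset_right inter_subset_right⟩
    · exact hΔQ.mono inter_subset_right inter_subset_right
  generalize (U i ∩ Δ).card = p at *
  generalize (U i ∩ Q).card = q at *
  generalize (U i ∩ M).card = r at *
  generalize (U i ∩ W).card = u at *
  have ht : (0 : ℚ) ≤ Q.card := Nat.cast_nonneg _
  have hd : (0 : ℚ) ≤ Δ.card := Nat.cast_nonneg _
  generalize (Q.card : ℚ) = t at *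
  generalize (Δ.card : ℚ) = δ at *
  have main : (t + δ) * (((p : ℚ) + q + r) / u) + (((q : ℚ) + p) * r) / (u * ((u : ℚ) - 1)) ≤
      t + δ + 1 / 2 := by
    have hc : (p : ℚ) + q + r ≤ u := by exact_mod_cast hcard
    have A1 : ((p : ℚ) + q + r) / u ≤ 1 := div_le_one_of_le₀ hc (by positivity)
    have A2 : (((q : ℚ) + p) * r) / (u * ((u : ℚ) - 1)) ≤ 1 / 2 := by
      rcases Nat.lt_or_ge u 2 with hu | hu
      · have : (u : ℚ) * ((u : ℚ) - 1) = 0 := by interval_cases u <;> simp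
        rw [this, div_zero]; norm_num
      · have hu' : (2 : ℚ) ≤ u := by exact_mod_cast hu
        rw [div_le_iff₀ (by nlinarith)]
        nlinarith [sq_nonneg ((q : ℚ) + p - r), Nat.cast_nonneg (α := ℚ) p,
          Nat.cast_nonneg (α := ℚ) q, Nat.cast_nonneg (α := ℚ) r]
    nlinarith [mul_le_mul_of_nonneg_left A1 (add_nonneg ht hd)]
  have hq : 0 ≤ δ * ((q : ℚ) / u) := by positivity
  refine le_trans ?_ main
  have : (t + δ) * (((p : ℚ) + q + r) / u) + (((q : ℚ) + p) * r) / (u * ((u : ℚ) - 1)) -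
    ((t * q + t * r) / u + q * r / (u * ((u : ℚ) - 1)) + ((t * p + δ * r) / u +
      p * r / (u * ((u : ℚ) - 1))) + δ * (p / u)) = δ * ((q : ℚ) / u) := by ring
  linarith

end Swap

theorem card_div_le_sum_inv {S : Finset V} (hS : S.Nonempty) (u : V → ℕ) {v c : ℚ} (hc : 0 < c)
    (hv : v = (∑ i ∈ S, (u i : ℚ)) / S.card) :
    (S.card : ℚ) / (v + c) ≤ ∑ i ∈ S, 1 / ((u i : ℚ) + c) := by
  have hs : (0 : ℚ) < S.card := by exact_mod_cast hS.card_pos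
  have hv0 : 0 ≤ v := by rw [hv]; positivity
  have hsum : ∑ i ∈ S, (u i : ℚ) = v * S.card := by rw [hv]; field_simp
  have h : ∀ i ∈ S, 2 / (v + c) - ((u i : ℚ) + c) / (v + c) ^ 2 ≤ 1 / ((u i : ℚ) + c) := by
    intro i _
    have h1 : 0 < (u i : ℚ) + c := by positivity
    have h2 : 0 < v + c := by positivity
    rw [← sub_nonneg]
    have : 1 / ((u i : ℚ) + c) - (2 / (v + c) - ((u i : ℚ) + c) / (v + c) ^ 2) =
      (u i - v) ^ 2 / (((u i : ℚ) + c) * (v + c) ^ 2) := by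
      field_simp
      ring
    rw [this]
    positivity
  refine le_trans (le_of_eq ?_) (sum_le_sum h)
  rw [sum_sub_distrib, ← sum_div _ _ ((v + c) ^ 2), sum_add_distrib, hsum]
  simp only [sum_const, nsmul_eq_mul]
  have h2 : v + c ≠ 0 := by positivity
  rw [mul_comm v, ← mul_add]
  have e : ∀ a x : ℚ, x ≠ 0 → a / x = a * (2 / x) - a * x / x ^ 2 := by
    intro a x hx
    field_simp
    ring
  exact e _ _ h2

/-- The arithmetic behind the swap arguments that exchange single elements. -/
theorem lt_add_one_of_single {n s w ℓ τ : ℚ} (hns : s ≤ n) (hw : 0 < w)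
    (h : τ * (s / w) ≤ n - s) (hc : ℓ * n < s * (τ + ℓ)) : ℓ < w := by
  by_contra! hle
  have h1 : τ * s ≤ (n - s) * w := by
    have := mul_le_mul_of_nonneg_right h hw.le
    rwa [mul_assoc, div_mul_cancel₀ _ hw.ne'] at this
  nlinarith [mul_le_mul_of_nonneg_left hle (sub_nonneg.2 hns)]

/-- The arithmetic behind the swap argument that also exchanges pairs of elements. -/
theorem sub_half_le_of_double {n s w ℓ t δ r : ℚ} (hs : 0 < s) (hns : s ≤ n) (hw : 1 ≤ w)
    (ht : 0 ≤ t) (hδ : 0 ≤ δ) (hr : 0 ≤ r) (hrw : r + 1 ≤ w) (hℓ : 0 < ℓ)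
    (h : ((t + δ) * (t + δ + r + 1) - t * δ) * (s / w) - (t + δ) * s + t * δ * (s / (w + 1)) ≤
      (n - s) * (t + δ + 1 / 2))
    (hc : ℓ * n < s * (t + δ + r + 1)) : ℓ - 1 / 2 ≤ w := by
  by_contra! hlt
  set σ := t + δ with hσ
  obtain ⟨K, hK⟩ : ∃ K, K = σ + r + 1 := ⟨_, rfl⟩
  rw [← hK] at hc
  have hK' : σ + r + 1 = K := hK.symm
  rw [hK'] at h
  have hKl : ℓ < K := by nlinarith
  have hσK : K - ℓ < σ := by linarith
  have hσ0 : 0 < σ := by linarith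
  have htd : t * δ ≤ σ ^ 2 / 4 := by rw [hσ]; nlinarith [sq_nonneg (t - δ)]
  have hw0 : 0 < w := by linarith
  have h1 : σ * K / w - t * δ / (w * (w + 1)) - σ < (K - ℓ) / ℓ * (σ + 1 / 2) := by
    have e : ((σ * K - t * δ) * (s / w) - σ * s + t * δ * (s / (w + 1))) =
      s * (σ * K / w - t * δ / (w * (w + 1)) - σ) := by
      field_simp
      ring
    rw [e] at h
    have h2 : n - s < s * ((K - ℓ) / ℓ) := by
      rw [← mul_div_assoc, lt_div_iff₀ hℓ]; linarith
    have h3 : (n - s) * (σ + 1 / 2) < s * ((K - ℓ) / ℓ) * (σ + 1 / 2) :=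
      mul_lt_mul_of_pos_right h2 (by linarith)
    rw [mul_assoc] at h3
    exact lt_of_mul_lt_mul_left (h.trans_lt h3) hs.le
  have h2 : σ * K * (ℓ - w) < t * δ * (ℓ / (w + 1)) + (K - ℓ) * w / 2 := by
    have e : (σ * K / w - t * δ / (w * (w + 1)) - σ) * (w * ℓ) =
      σ * K * ℓ - t * δ * (ℓ / (w + 1)) - σ * w * ℓ := by
      field_simp
    have e' : (K - ℓ) / ℓ * (σ + 1 / 2) * (w * ℓ) = (K - ℓ) * (σ + 1 / 2) * w := by
      field_simp
    have := mul_lt_mul_of_pos_right h1 (show 0 < w * ℓ by positivity)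
    rw [e, e'] at this
    nlinarith
  have hg : ℓ / (w + 1) ≤ 2 * (ℓ - w) := by
    rw [div_le_iff₀ (by linarith)]
    nlinarith
  have h3 : t * δ * (ℓ / (w + 1)) ≤ σ ^ 2 / 4 * (2 * (ℓ - w)) :=
    mul_le_mul htd hg (by positivity) (by positivity)
  have h4 : (K - ℓ) * w / 2 ≤ (K - ℓ) * ℓ * (ℓ - w) := by
    have : w * (1 / 2) ≤ ℓ * (ℓ - w) := mul_le_mul (by linarith) (by linarith) (by norm_num) hℓ.le
    nlinarith
  have h5 : σ ^ 2 / 2 + (K - ℓ) * ℓ ≤ σ * K := by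
    have : σ ≤ K := by linarith
    nlinarith [mul_nonneg (sub_nonneg.2 hσK.le) (sub_nonneg.2 this), sq_nonneg (K - ℓ)]
  nlinarith [mul_le_mul_of_nonneg_right h5 (show 0 ≤ ℓ - w by linarith)]

section Feasibility

variable [DecidableEq C]

@[simp] theorem inl_mem_posOf {X : Finset C} {c : C} : Sum.inl c ∈ posOf X ↔ c ∈ X := by
  simp [posOf]

@[simp] theorem inr_notMem_posOf {X : Finset C} {c : C} : Sum.inr c ∉ posOf X := by
  simp [posOf]

@[simp] theorem inr_mem_negOf {X : Finset C} {c : C} : Sum.inr c ∈ negOf X ↔ c ∈ X := by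
  simp [negOf]

@[simp] theorem inl_notMem_negOf {X : Finset C} {c : C} : Sum.inl c ∉ negOf X := by
  simp [negOf]

theorem card_posOf (X : Finset C) : (posOf X).card = X.card :=
  card_image_of_injective _ Sum.inl_injective

theorem card_negOf (X : Finset C) : (negOf X).card = X.card :=
  card_image_of_injective _ Sum.inr_injective

theorem disjoint_posOf_negOf (X Y : Finset C) : Disjoint (posOf X) (negOf Y) := by
  rw [Finset.disjoint_left]
  rintro (c | c) <;> simp

theorem card_posOf_union_negOf (X Y : Finset C) :
    (posOf X ∪ negOf Y).card = X.card + Y.card := by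
  rw [card_union_of_disjoint (disjoint_posOf_negOf X Y), card_posOf, card_negOf]

theorem card_insert_erase_le {P : Finset C} {b c : C} (hb : b ∈ P) :
    (insert c (P.erase b)).card ≤ P.card := by
  have := card_insert_le c (P.erase b)
  have := card_erase_add_one hb
  omega

variable [Fintype C]

@[simp] theorem mem_posPart {W : Finset (C ⊕ C)} {c : C} : c ∈ posPart W ↔ Sum.inl c ∈ W := by
  simp [_root_.posPart]

theorem mem_comInt {F : V → Finset C} {S : Finset V} {c : C} :
    c ∈ comInt F S ↔ ∀ i ∈ S, c ∈ F i := by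
  simp [comInt]

theorem Feasible.mono {k : ℕ} {W T : Finset (C ⊕ C)} (hW : Feasible k W) (hT : T ⊆ W) :
    Feasible k T :=
  ⟨(card_le_card fun c hc => by simp only [mem_posPart] at hc ⊢; exact hT hc).trans hW.1,
    fun c hc => hW.2 c ⟨hT hc.1, hT hc.2⟩⟩

theorem Feasible.swap {k : ℕ} {W Z Y : Finset (C ⊕ C)} (hW : Feasible k W)
    (hcard : (posPart (W \ Z ∪ Y)).card ≤ k)
    (hY : ∀ x ∈ Y, x.swap ∉ W \ Z ∧ x.swap ∉ Y) : Feasible k (W \ Z ∪ Y) := by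
  refine ⟨hcard, fun c hc => ?_⟩
  have h1 := hY (Sum.inl c)
  have h2 := hY (Sum.inr c)
  have h3 := hW.2 c
  simp only [Sum.swap_inl, Sum.swap_inr, mem_union, mem_sdiff] at *
  tauto

variable [Fintype V] {A D : V → Finset C} {k ℓ : ℕ} {S : Finset V}

theorem Cohesive.bound (hcoh : Cohesive A D k ℓ S) (hℓ : 0 < ℓ) (hS : S.Nonempty)
    {T : Finset (C ⊕ C)} (hT : Feasible k T)
    (hX : ∀ X ⊆ posOf (comInt A S) ∪ negOf (comInt D S), Feasible k (T ∪ X) → X.card < ℓ) :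
    (ℓ : ℚ) * (Fintype.card V : ℚ) < (S.card : ℚ) * ((T.card : ℚ) + (ℓ : ℚ)) := by
  rcases hcoh T hT with ⟨X, hXR, hXc, hXf⟩ | h
  · exact absurd (hX X hXR hXf) (by omega)
  · have hn : (0 : ℚ) < Fintype.card V := by
      obtain ⟨i, _⟩ := hS
      exact_mod_cast Fintype.card_pos_iff.2 ⟨i⟩
    have hℓ' : (0 : ℚ) < ℓ := by exact_mod_cast hℓ
    rwa [div_lt_div_iff₀ (by positivity) hn] at h

theorem Cohesive.bound_of_swap (hcoh : Cohesive A D k ℓ S) (hℓ : 0 < ℓ) (hS : S.Nonempty)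
    {T : Finset (C ⊕ C)} (hT : Feasible k T)
    (hTR : T.image Sum.swap ⊆ posOf (comInt A S) ∪ negOf (comInt D S))
    (hcard : (posOf (comInt A S) ∪ negOf (comInt D S)).card < ℓ + T.card) :
    (ℓ : ℚ) * (Fintype.card V : ℚ) < (S.card : ℚ) * ((T.card : ℚ) + (ℓ : ℚ)) := by
  refine hcoh.bound hℓ hS hT fun X hXR hXf => ?_
  have hdisj : Disjoint X (T.image Sum.swap) := by
    rw [Finset.disjoint_right]
    intro x hx hxX
    obtain ⟨y, hy, rfl⟩ := mem_image.1 hx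
    rcases y with c | c
    · exact hXf.2 c ⟨mem_union_left _ hy, mem_union_right _ hxX⟩
    · exact hXf.2 c ⟨mem_union_right _ hxX, mem_union_left _ hy⟩
  have h1 := card_le_card (union_subset hXR hTR)
  rw [card_union_of_disjoint hdisj,
    card_image_of_injective _ Sum.swap_leftInverse.injective] at h1
  omega

theorem Cohesive.bound_of_pos (hcoh : Cohesive A D k ℓ S) (hℓ : 0 < ℓ) (hS : S.Nonempty)
    {T : Finset C} (hT : Feasible k (posOf T)) (hTA : Disjoint T (comInt A S))
    (hcard : k + (comInt D S \ T).card < ℓ + T.card) :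
    (ℓ : ℚ) * (Fintype.card V : ℚ) < (S.card : ℚ) * ((T.card : ℚ) + (ℓ : ℚ)) := by
  rw [← card_posOf T]
  refine hcoh.bound hℓ hS hT fun X hXR hXf => ?_
  have h1 : X ⊆ posOf (posPart X) ∪ negOf (comInt D S \ T) := by
    rintro (c | c) hc
    · simpa using hc
    · have h2 := hXR hc
      have h3 := hXf.2 c
      simp only [mem_union, inl_mem_posOf, inr_notMem_posOf, inr_mem_negOf, mem_sdiff,
        false_or] at *
      tauto
  have h2 := card_le_card h1
  rw [card_posOf_union_negOf] at h2
  have h3 : Disjoint T (posPart X) := by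
    refine hTA.mono_right fun c hc => ?_
    simpa using hXR (mem_posPart.1 hc)
  have h4 : (T ∪ posPart X).card ≤ k := by
    refine le_trans (card_le_card fun c hc => ?_) hXf.1
    simpa using hc
  rw [card_union_of_disjoint h3] at h4
  omega

end Feasibility

theorem sum_single_lower {S : Finset V} (hS : S.Nonempty) (u q : V → ℕ) (τ r : ℕ) {v : ℚ}
    (hv : v = (∑ i ∈ S, (u i : ℚ)) / S.card) (hq : ∀ i ∈ S, q i + r ≤ u i) :
    ((τ : ℚ) + r + 1) * ((S.card : ℚ) / (v + 1)) - S.card ≤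
      ∑ i ∈ S, ((τ : ℚ) - (q i : ℚ)) / ((u i : ℚ) + 1) := by
  have h1 := mul_le_mul_of_nonneg_left (card_div_le_sum_inv hS u one_pos hv)
    (show (0 : ℚ) ≤ τ + r + 1 by positivity)
  have h2 : ∑ i ∈ S, (((τ : ℚ) + r + 1) * (1 / ((u i : ℚ) + 1)) - 1) ≤
      ∑ i ∈ S, ((τ : ℚ) - (q i : ℚ)) / ((u i : ℚ) + 1) := by
    refine sum_le_sum fun i hi => ?_
    have hqi : (q i : ℚ) + r ≤ u i := by exact_mod_cast hq i hi
    have hu : (0 : ℚ) < (u i : ℚ) + 1 := by positivity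
    rw [le_div_iff₀ hu, sub_mul, mul_assoc, one_div_mul_cancel hu.ne']
    linarith
  rw [sum_sub_distrib, ← mul_sum] at h2
  simp only [sum_const, nsmul_eq_mul, mul_one] at h2
  linarith

theorem sum_double_lower {S : Finset V} (hS : S.Nonempty) (u q : V → ℕ) (t δ r : ℕ) {v : ℚ}
    (hv : v = (∑ i ∈ S, (u i : ℚ)) / S.card) (hq : ∀ i ∈ S, q i + r ≤ u i) :
    (((t : ℚ) + δ) * (t + δ + r + 1) - t * δ) * ((S.card : ℚ) / (v + 1)) - (t + δ) * S.card +
        t * δ * ((S.card : ℚ) / (v + 1 + 1)) ≤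
      ∑ i ∈ S, ((t : ℚ) * ((t : ℚ) - (q i : ℚ)) / ((u i : ℚ) + 1)
        + (t : ℚ) * (δ : ℚ) * (1 / ((u i : ℚ) + 1) + 1 / ((u i : ℚ) + 2))
        + (δ : ℚ) * (δ : ℚ) * (1 / ((u i : ℚ) + 1))) := by
  have h1 := mul_le_mul_of_nonneg_left (card_div_le_sum_inv hS u one_pos hv)
    (show (0 : ℚ) ≤ ((t : ℚ) + δ) * (t + δ + r + 1) - t * δ by ring_nf; positivity)
  have h1' := mul_le_mul_of_nonneg_left (card_div_le_sum_inv hS u two_pos hv)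
    (show (0 : ℚ) ≤ (t : ℚ) * δ by positivity)
  have h2 : ∑ i ∈ S, ((((t : ℚ) + δ) * (t + δ + r + 1) - t * δ) * (1 / ((u i : ℚ) + 1)) -
        (t + δ) + t * δ * (1 / ((u i : ℚ) + 2))) ≤
      ∑ i ∈ S, ((t : ℚ) * ((t : ℚ) - (q i : ℚ)) / ((u i : ℚ) + 1)
        + (t : ℚ) * (δ : ℚ) * (1 / ((u i : ℚ) + 1) + 1 / ((u i : ℚ) + 2))
        + (δ : ℚ) * (δ : ℚ) * (1 / ((u i : ℚ) + 1))) := by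
    refine sum_le_sum fun i hi => ?_
    have hqi : (q i : ℚ) + r ≤ u i := by exact_mod_cast hq i hi
    have hu : (0 : ℚ) < (u i : ℚ) + 1 := by positivity
    have h3 : ((t : ℚ) + δ) = (t + δ) * (((u i : ℚ) + 1) * (1 / ((u i : ℚ) + 1))) := by
      rw [mul_one_div_cancel hu.ne', mul_one]
    have h4 : (0 : ℚ) ≤ ((t + δ) * (u i - r) - t * q i) * (1 / ((u i : ℚ) + 1)) := by
      refine mul_nonneg ?_ (by positivity)
      have h5 : (t : ℚ) * q i ≤ (t + δ) * (u i - r) :=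
        mul_le_mul (by linarith [Nat.cast_nonneg (α := ℚ) δ]) (by linarith) (by positivity)
          (by positivity)
      linarith
    rw [div_eq_mul_one_div ((t : ℚ) * ((t : ℚ) - (q i : ℚ)))]
    linarith
  rw [sum_add_distrib, sum_sub_distrib, ← mul_sum, ← mul_sum] at h2
  simp only [sum_const, nsmul_eq_mul] at h2
  have e : v + 1 + 1 = v + 2 := by ring
  rw [e]
  linarith

/-- if `W` is a feasible outcome maximizing the PAV score
`∑_i H(|W ∩ (A_i ∪ ¬D_i)|)` over all feasible outcomes, then every nonempty
`ℓ`-cohesive group `S` has average satisfaction at least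
`(1 - 2/(k+4))·ℓ - 3/2`. -/
theorem stmt_5 [Fintype C] [DecidableEq C] [Fintype V] [DecidableEq V]
    (k : ℕ) (A D : V → Finset C)
    (hdisj : ∀ i, Disjoint (A i) (D i)) (hk : 0 < k) (hkm : k ≤ Fintype.card C)
    (W : Finset (C ⊕ C)) (hW : Feasible k W)
    (hmax : ∀ W' : Finset (C ⊕ C), Feasible k W' →
      ∑ i : V, harm (util A D i W') ≤ ∑ i : V, harm (util A D i W))
    (S : Finset V) (hS : S.Nonempty) (ℓ : ℕ) (hℓ : 0 < ℓ)
    (hcoh : Cohesive A D k ℓ S) :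
    (1 - 2 / ((k : ℚ) + 4)) * (ℓ : ℚ) - 3 / 2 ≤
      (∑ i ∈ S, (util A D i W : ℚ)) / (S.card : ℚ) := by
  by_contra! hcon
  obtain ⟨v, hv⟩ : ∃ v, v = (∑ i ∈ S, (util A D i W : ℚ)) / (S.card : ℚ) := ⟨_, rfl⟩
  rw [← hv] at hcon
  have hlt : v + 1 < (ℓ : ℚ) - 1 / 2 := by
    have : 0 ≤ 2 / ((k : ℚ) + 4) * (ℓ : ℚ) := by positivity
    linarith
  refine absurd hlt (not_lt.2 ?_)
  clear hcon
  -- notation and basic facts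
  let U : V → Finset (C ⊕ C) := fun i => posOf (A i) ∪ negOf (D i)
  have hU : ∀ i, (U i ∩ W).card = util A D i W := fun _ => rfl
  obtain ⟨As, hAs⟩ : ∃ As, As = comInt A S := ⟨_, rfl⟩
  obtain ⟨Ds, hDs⟩ : ∃ Ds, Ds = comInt D S := ⟨_, rfl⟩
  obtain ⟨P, hP⟩ : ∃ P, P = _root_.posPart W := ⟨_, rfl⟩
  obtain ⟨R, hR⟩ : ∃ R, R = posOf As ∪ negOf Ds := ⟨_, rfl⟩
  have memP : ∀ c, c ∈ P ↔ Sum.inl c ∈ W := fun c => by rw [hP, mem_posPart]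
  have memRl : ∀ c, Sum.inl c ∈ R ↔ c ∈ As := fun c => by simp [hR]
  have memRr : ∀ c, Sum.inr c ∈ R ↔ c ∈ Ds := fun c => by simp [hR]
  have memUl : ∀ i c, Sum.inl c ∈ U i ↔ c ∈ A i := fun i c => by simp [U]
  have memUr : ∀ i c, Sum.inr c ∈ U i ↔ c ∈ D i := fun i c => by simp [U]
  have hAD : ∀ i c, c ∈ A i → c ∉ D i := fun i c h1 h2 =>
    Finset.disjoint_left.1 (hdisj i) h1 h2
  have hRU : ∀ x ∈ R, ∀ i ∈ S, x ∈ U i := by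
    rintro (c | c) hc i hi
    · rw [memRl, hAs, mem_comInt] at hc
      exact (memUl i c).2 (hc i hi)
    · rw [memRr, hDs, mem_comInt] at hc
      exact (memUr i c).2 (hc i hi)
  have hRU' : ∀ x ∈ R, ∀ i ∈ S, x.swap ∉ U i := by
    rintro (c | c) hc i hi
    · rw [memRl, hAs, mem_comInt] at hc
      exact fun h => hAD i c (hc i hi) ((memUr i c).1 h)
    · rw [memRr, hDs, mem_comInt] at hc
      exact fun h => hAD i c ((memUl i c).1 h) (hc i hi)
  have hADs : ∀ c ∈ Ds, c ∉ As := by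
    obtain ⟨i, hi⟩ := hS
    intro c h1 h2
    rw [hDs, mem_comInt] at h1
    rw [hAs, mem_comInt] at h2
    exact hAD i c (h2 i hi) (h1 i hi)
  have hs : (0 : ℚ) < S.card := by exact_mod_cast hS.card_pos
  have hℓ' : (0 : ℚ) < ℓ := by exact_mod_cast hℓ
  have hn : (Sᶜ.card : ℚ) = (Fintype.card V : ℚ) - S.card := by
    rw [eq_sub_iff_add_eq, add_comm]; exact_mod_cast card_add_card_compl S
  have hsn : (S.card : ℚ) ≤ Fintype.card V := by exact_mod_cast card_le_univ S
  have hv0 : 0 ≤ v := by rw [hv]; positivity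
  obtain ⟨r, hr⟩ : ∃ r, r = (R ∩ W).card := ⟨_, rfl⟩
  have hrv : (r : ℚ) ≤ v := by
    rw [hv, le_div_iff₀ hs, mul_comm, ← nsmul_eq_mul]
    refine card_nsmul_le_sum _ _ _ fun i hi => ?_
    rw [← hU, hr]
    exact_mod_cast card_le_card (inter_subset_inter_right fun x hx => hRU x hx i hi)
  have hrℓ : r < ℓ := by
    have : (r : ℚ) < ℓ := by linarith
    exact_mod_cast this
  have hquota : ∀ T : Finset (C ⊕ C), T ⊆ W → Disjoint T R → ∀ i ∈ S,
      (U i ∩ T).card + r ≤ util A D i W := by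
    intro T hTW hTR i hi
    rw [hr, ← hU, ← card_union_of_disjoint]
    · refine card_le_card (union_subset (inter_subset_inter_left hTW) ?_)
      exact inter_subset_inter_right fun x hx => hRU x hx i hi
    · exact hTR.mono inter_subset_right inter_subset_left
  have hopt : ∀ W', Feasible k W' →
      ∑ i, harm (U i ∩ W').card ≤ ∑ i, harm (U i ∩ W).card := hmax
  have hPk : P.card ≤ k := hP ▸ hW.1
  -- no element supported by all of `S` can be added for free
  have hfree : ∀ x ∈ R, x ∉ W → ¬ Feasible k (W \ ∅ ∪ {x}) := by
    intro x hxR hxW hf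
    have h1 := sum_gain_le_sum_loss _ _ S
      (fun i => 1 / (((U i ∩ W).card : ℚ) + 1)) (fun _ => 0) (hopt _ hf)
      (fun i hi => by
        have h2 := card_swap (U i) W ∅ {x} (by simpa using hRU x hxR i hi) (by simpa using hxW)
        rw [inter_empty, card_empty, card_singleton, add_zero] at h2
        have h3 := harm_mono h2
        rw [harm_succ] at h3
        linarith)
      (fun i _ => by
        have h2 := card_le_card_swap_add (U i) W ∅ {x}
        rw [inter_empty, card_empty, add_zero] at h2
        have h3 := harm_mono h2
        linarith)
    rw [sum_const_zero] at h1
    have h4 : 0 < ∑ i ∈ S, 1 / (((U i ∩ W).card : ℚ) + 1) :=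
      sum_pos (fun i _ => by positivity) hS
    linarith
  -- exchanging elements of `W` for their opposites
  have hpure : ∀ T : Finset (C ⊕ C), T ⊆ W → T.image Sum.swap ⊆ R →
      (∀ y ∈ T, Feasible k (W \ {y} ∪ {y.swap})) →
      (ℓ : ℚ) * (Fintype.card V : ℚ) < (S.card : ℚ) * ((T.card : ℚ) + (ℓ : ℚ)) →
      (ℓ : ℚ) - 1 / 2 ≤ v + 1 := by
    intro T hTW hTR hTf hb
    have hyR : ∀ y ∈ T, y.swap ∈ R := fun y hy => hTR (mem_image_of_mem _ hy)
    have hyU : ∀ i ∈ S, U i ∩ T = ∅ := by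
      intro i hi
      rw [← disjoint_iff_inter_eq_empty, Finset.disjoint_right]
      intro y hy
      simpa using hRU' _ (hyR y hy) i hi
    have h1 := sum_single_swap U W S hTW fun y hy =>
      single_swap U W S (x := y.swap) (fun h => by
        rcases y with c | c
        · exact hW.2 c ⟨hTW hy, h⟩
        · exact hW.2 c ⟨h, hTW hy⟩) (hTW hy) (hRU _ (hyR y hy)) (hopt _ (hTf y hy))
    have h2 := mul_le_mul_of_nonneg_left
      (card_div_le_sum_inv hS (fun i => util A D i W) one_pos hv) (Nat.cast_nonneg (α := ℚ) T.card)
    have h3 : (T.card : ℚ) * ((S.card : ℚ) / (v + 1)) ≤ (Fintype.card V : ℚ) - S.card := by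
      rw [← hn]
      refine h2.trans (le_trans (le_of_eq ?_) h1)
      rw [mul_sum]
      refine sum_congr rfl fun i hi => ?_
      rw [hyU i hi, hU, card_empty, Nat.cast_zero, sub_zero, mul_one_div]
    have := lt_add_one_of_single hsn (by linarith) h3 hb
    linarith
  have hswapne : ∀ y ∈ W, y.swap ∉ W := by
    rintro (c | c) h1 h2
    · exact hW.2 c ⟨h1, h2⟩
    · exact hW.2 c ⟨h2, h1⟩
  have hsub : ∀ T : Finset (C ⊕ C), T ⊆ W → Feasible k T := fun T hT => hW.mono hT
  have hcardR : R.card = As.card + Ds.card := by rw [hR, card_posOf_union_negOf]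
  rcases hPk.lt_or_eq with hPlt | hPeq
  · -- there is room for a further positive candidate
    have hpc : ∀ (Z : Finset (C ⊕ C)) (x : C ⊕ C),
        (_root_.posPart (W \ Z ∪ {x})).card ≤ k := by
      intro Z x
      rcases x with c | c
      · refine le_trans (card_le_card (t := insert c P) fun b hb => ?_)
          ((card_insert_le _ _).trans hPlt)
        simp only [mem_posPart, mem_union, mem_sdiff, mem_singleton, Sum.inl.injEq] at hb
        rw [mem_insert, memP]; tauto
      · refine le_trans (card_le_card (t := P) fun b hb => ?_) hPk
        simp only [mem_posPart, mem_union, mem_sdiff, mem_singleton, reduceCtorEq] at hb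
        rw [memP]; tauto
    have hopp : ∀ x ∈ R, x ∉ W → x.swap ∈ W := by
      intro x hxR hxW
      by_contra hx
      refine hfree x hxR hxW (hW.swap (hpc _ _) ?_)
      rintro _ h
      rw [mem_singleton.1 h]
      refine ⟨by simpa using hx, ?_⟩
      rcases x with c | c <;> simp
    have hTW : (R \ W).image Sum.swap ⊆ W := by
      intro y hy
      obtain ⟨x, hx, rfl⟩ := mem_image.1 hy
      rw [mem_sdiff] at hx
      exact hopp x hx.1 hx.2
    have hTT : ((R \ W).image Sum.swap).image Sum.swap = R \ W := by
      rw [image_image, Sum.swap_swap_eq, image_id]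
    have hTc : ((R \ W).image Sum.swap).card + r = R.card := by
      rw [card_image_of_injective _ Sum.swap_leftInverse.injective, hr, add_comm,
        card_inter_add_card_sdiff]
    refine hpure _ hTW (by rw [hTT]; exact sdiff_subset) (fun y hy => ?_) ?_
    · refine hW.swap (hpc _ _) ?_
      rintro _ h
      rw [mem_singleton.1 h, Sum.swap_swap]
      refine ⟨by simp, ?_⟩
      rcases y with c | c <;> simp
    · refine hcoh.bound_of_swap hℓ hS (hsub _ hTW) ?_ ?_
      · rw [hTT, ← hAs, ← hDs, ← hR]; exact sdiff_subset
      · rw [← hAs, ← hDs, ← hR]; omega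
  -- now `W` contains exactly `k` positive candidates
  have hneg : ∀ c ∈ Ds, Sum.inr c ∉ W → c ∈ P := by
    intro c hc hcW
    by_contra hcP
    rw [memP] at hcP
    refine hfree _ ((memRr c).2 hc) hcW (hW.swap ?_ ?_)
    · refine le_trans (card_le_card (t := P) fun b hb => ?_) hPk
      simp only [mem_posPart, mem_union, mem_sdiff, mem_singleton, reduceCtorEq] at hb
      rw [memP]; tauto
    · simpa using hcP
  obtain ⟨Δ, hΔ⟩ : ∃ Δ, Δ = Ds ∩ P := ⟨_, rfl⟩
  obtain ⟨Q₀, hQ₀⟩ : ∃ Q₀ : Finset C, Q₀ = ((P \ As) \ Ds) := ⟨_, rfl⟩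
  have hΔP : Δ ⊆ P := hΔ ▸ inter_subset_right
  have hΔD : Δ ⊆ Ds := hΔ ▸ inter_subset_left
  have hQP : Q₀ ⊆ P := hQ₀ ▸ sdiff_subset.trans sdiff_subset
  have posOfW : ∀ T ⊆ P, posOf T ⊆ W := by
    rintro T hT (c | c) hc
    · exact (memP c).1 (hT (inl_mem_posOf.1 hc))
    · simp at hc
  have hrcard : r = (As ∩ P).card + (Ds \ P).card := by
    rw [hr, ← card_posOf_union_negOf]
    congr 1
    ext x
    rcases x with c | c
    · simp [memRl, memP]
    · have h1 := hneg c
      have h2 := hW.2 c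
      have h3 := memP c
      have h4 := memRr c
      simp only [mem_inter, mem_union, inr_notMem_posOf, inr_mem_negOf, mem_sdiff, false_or]
      tauto
  have hDcard : Δ.card + (Ds \ P).card = Ds.card := by rw [hΔ, card_inter_add_card_sdiff]
  have hPcard : (As ∩ P).card + Δ.card + Q₀.card = k := by
    rw [← hPeq, ← card_inter_add_card_sdiff P As, inter_comm As P,
      ← card_inter_add_card_sdiff (P \ As) Ds, ← hQ₀, ← add_assoc]
    congr 3
    ext c
    have := hADs c
    simp only [hΔ, mem_inter, mem_sdiff]; tauto
  have hΔswap : ∀ c ∈ Δ, Feasible k (W \ {Sum.inl c} ∪ {Sum.inr c}) := by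
    intro c hc
    refine hW.swap ?_ (by simp)
    refine le_trans (card_le_card (t := P) fun b hb => ?_) hPk
    simp only [mem_posPart, mem_union, mem_sdiff, mem_singleton, reduceCtorEq] at hb
    rw [memP]; tauto
  have hΔA : Disjoint Δ As := Finset.disjoint_left.2 fun c hc => hADs c (hΔD hc)
  have hQA : Disjoint Q₀ As := by rw [hQ₀]; exact disjoint_sdiff_self_left.mono_left sdiff_subset
  have hΔQ : Disjoint Δ Q₀ := by
    rw [hQ₀]; exact disjoint_sdiff_self_right.mono_left hΔD
  by_cases hbig : k + Ds.card < ℓ + 2 * Δ.card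
  · -- the disapproved elected candidates alone block
    refine hpure (posOf Δ) (posOfW _ hΔP) ?_ ?_ ?_
    · rintro _ h
      obtain ⟨(c | c), hc, rfl⟩ := mem_image.1 h
      · exact (memRr c).2 (hΔD (inl_mem_posOf.1 hc))
      · simp at hc
    · rintro (c | c) hc
      · exact hΔswap c (inl_mem_posOf.1 hc)
      · simp at hc
    · rw [card_posOf]
      refine hcoh.bound_of_pos hℓ hS (hsub _ (posOfW _ hΔP)) (hAs ▸ hΔA) ?_
      rw [← hDs, card_sdiff_of_subset hΔD]
      have := card_le_card hΔD
      omega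
  -- blocking by positive candidates
  have hblock : (ℓ : ℚ) * (Fintype.card V : ℚ) <
      (S.card : ℚ) * ((Q₀.card : ℚ) + Δ.card + r + 1) := by
    obtain ⟨Q₁, hQ₁, hQ₁c⟩ := exists_subset_card_eq
      (show k + Ds.card + 1 - ℓ - 2 * Δ.card ≤ Q₀.card by omega)
    have hTc : (Δ ∪ Q₁).card = Δ.card + Q₁.card :=
      card_union_of_disjoint (hΔQ.mono_right hQ₁)
    have hTD : Ds \ (Δ ∪ Q₁) = Ds \ Δ := by
      ext c
      have h1 := @hQ₁ c
      simp only [hQ₀, mem_sdiff, mem_union] at h1 ⊢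
      tauto
    have hb := hcoh.bound_of_pos hℓ hS
      (hsub _ (posOfW (Δ ∪ Q₁) (union_subset hΔP (hQ₁.trans hQP))))
      (hAs ▸ disjoint_union_left.2 ⟨hΔA, hQA.mono_left hQ₁⟩) (by
        rw [← hDs, hTD, hTc, card_sdiff_of_subset hΔD]
        have := card_le_card hΔD
        omega)
    have hc : (Δ ∪ Q₁).card + ℓ = Q₀.card + Δ.card + r + 1 := by
      rw [hTc]; omega
    have hc' : ((Δ ∪ Q₁).card : ℚ) + ℓ = (Q₀.card : ℚ) + Δ.card + r + 1 := by exact_mod_cast hc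
    rwa [hc'] at hb
  have hpc : ∀ (Z Y : Finset (C ⊕ C)) (b c : C), b ∈ P → Sum.inl b ∈ Z →
      (∀ x, Sum.inl x ∈ Y → x = c) → (_root_.posPart (W \ Z ∪ Y)).card ≤ k := by
    intro Z Y b c hb hbZ hY
    refine le_trans (card_le_card (t := insert c (P.erase b)) fun x hx => ?_)
      ((card_insert_erase_le hb).trans hPk)
    have h1 := hY x
    simp only [mem_posPart, mem_union, mem_sdiff] at hx
    rw [mem_insert, mem_erase, memP]
    by_cases hxb : x = b
    · subst hxb; tauto
    · tauto
  by_cases hα : ∃ c ∈ As, Sum.inl c ∉ W ∧ Sum.inr c ∉ W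
  · -- some jointly approved candidate can replace any elected one
    obtain ⟨c, hcA, hcW, hcW'⟩ := hα
    have hTP : Δ ∪ Q₀ ⊆ P := union_subset hΔP hQP
    have hTW := posOfW _ hTP
    have h1 := sum_single_swap U W S hTW fun y hy =>
      single_swap U W S (x := Sum.inl c) hcW (hTW hy) (hRU _ ((memRl c).2 hcA)) (hopt _ (by
        rcases y with b | b
        · exact hW.swap (hpc _ _ b c (hTP (inl_mem_posOf.1 hy)) (by simp) (by simp))
            (by simpa using hcW')
        · simp at hy))
    have hTR : Disjoint (posOf (Δ ∪ Q₀)) R := by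
      rw [Finset.disjoint_left]
      rintro (b | b) hb hbR
      · rw [inl_mem_posOf] at hb
        exact Finset.disjoint_left.1 (disjoint_union_left.2 ⟨hΔA, hQA⟩) hb ((memRl b).1 hbR)
      · simp at hb
    have h2 := sum_single_lower hS (fun i => util A D i W) (fun i => (U i ∩ posOf (Δ ∪ Q₀)).card)
      (posOf (Δ ∪ Q₀)).card r hv (hquota _ hTW hTR)
    have h3 := h2.trans h1
    rw [hn, card_posOf, card_union_of_disjoint hΔQ, Nat.cast_add] at h3
    have hw : (0 : ℚ) < v + 1 := by linarith
    have h4 : ((Δ.card : ℚ) + Q₀.card + r + 1) * (S.card : ℚ) ≤ Fintype.card V * (v + 1) := by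
      rw [← div_le_iff₀ hw, mul_div_assoc]; linarith
    have hnpos : (0 : ℚ) < Fintype.card V := hs.trans_le hsn
    have h5 : (Fintype.card V : ℚ) * ℓ < Fintype.card V * (v + 1) := by linarith
    have := lt_of_mul_lt_mul_left h5 hnpos.le
    linarith
  push Not at hα
  obtain ⟨M₀, hM₀⟩ : ∃ M₀ : Finset C, M₀ = (As \ P) := ⟨_, rfl⟩
  have hM₀W : ∀ c ∈ M₀, Sum.inr c ∈ W := by
    intro c hc
    rw [hM₀, mem_sdiff, memP] at hc
    exact hα c hc.1 hc.2
  have hM₀A : M₀ ⊆ As := hM₀ ▸ sdiff_subset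
  have hAcard : (As ∩ P).card + M₀.card = As.card := by rw [hM₀, card_inter_add_card_sdiff]
  have hblock' : (ℓ : ℚ) * (Fintype.card V : ℚ) <
      (S.card : ℚ) * ((M₀.card : ℚ) + Δ.card + r + 1) := by
    have hBW : posOf Δ ∪ negOf M₀ ⊆ W := by
      refine union_subset (posOfW _ hΔP) ?_
      rintro (c | c) hc
      · simp at hc
      · exact hM₀W c (inr_mem_negOf.1 hc)
    have hBR : (posOf Δ ∪ negOf M₀).image Sum.swap ⊆ R := by
      rintro _ h
      obtain ⟨(c | c), hc, rfl⟩ := mem_image.1 h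
      · exact (memRr c).2 (hΔD (by simpa using hc))
      · exact (memRl c).2 (hM₀A (by simpa using hc))
    have hBc := card_posOf_union_negOf Δ M₀
    obtain ⟨T, hTB, hTc⟩ := exists_subset_card_eq
      (show As.card + Ds.card + 1 - ℓ ≤ (posOf Δ ∪ negOf M₀).card by omega)
    have hb := hcoh.bound_of_swap hℓ hS (hsub _ (hTB.trans hBW))
      (by rw [← hAs, ← hDs, ← hR]; exact (image_subset_image hTB).trans hBR)
      (by rw [← hAs, ← hDs, ← hR]; omega)
    have hTpos : T.card ≠ 0 := by
      intro h0
      rw [h0, Nat.cast_zero, zero_add, mul_comm] at hb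
      have := lt_of_mul_lt_mul_right hb hℓ'.le
      linarith
    have hc : T.card + ℓ = M₀.card + Δ.card + r + 1 := by omega
    have hc' : (T.card : ℚ) + ℓ = (M₀.card : ℚ) + Δ.card + r + 1 := by exact_mod_cast hc
    rwa [hc'] at hb
  obtain ⟨t, ht⟩ : ∃ t, t = min M₀.card Q₀.card := ⟨_, rfl⟩
  have hb : (ℓ : ℚ) * (Fintype.card V : ℚ) < (S.card : ℚ) * ((t : ℚ) + Δ.card + r + 1) := by
    rcases min_choice M₀.card Q₀.card with h | h
    · rw [ht, h]; exact hblock'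
    · rw [ht, h]; exact hblock
  obtain ⟨M, hM, hMc⟩ := exists_subset_card_eq (show t ≤ M₀.card from ht ▸ min_le_left _ _)
  obtain ⟨Q, hQ, hQc⟩ := exists_subset_card_eq (show t ≤ Q₀.card from ht ▸ min_le_right _ _)
  have hMW : negOf M ⊆ W := by
    rintro (c | c) hc
    · simp at hc
    · exact hM₀W c (hM (inr_mem_negOf.1 hc))
  have hposOf : ∀ {X Y : Finset C}, Disjoint X Y → Disjoint (posOf X) (posOf Y) := by
    intro X Y h
    rw [Finset.disjoint_left] at h ⊢
    rintro (c | c) hc hc'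
    · exact h (inl_mem_posOf.1 hc) (inl_mem_posOf.1 hc')
    · simp at hc
  have hQW : posOf Q ⊆ W := posOfW _ (hQ.trans hQP)
  have hΔW : posOf Δ ⊆ W := posOfW _ hΔP
  have hMinl : ∀ c ∈ M, Sum.inl c ∉ W := by
    intro c hc
    have := hM hc
    rw [hM₀, mem_sdiff, memP] at this
    exact this.2
  have h1 := sum_double_swap U W S hΔW hQW hMW
    (hposOf (hΔQ.mono_right hQ)) (disjoint_posOf_negOf _ _) (disjoint_posOf_negOf _ _)
    (by rw [card_posOf, card_negOf, hMc, hQc])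
    (by
      rintro (b | b) hb
      · have hbΔ := inl_mem_posOf.1 hb
        have := single_swap U W S (x := Sum.inr b) (y := Sum.inl b) (hswapne _ (hΔW hb)) (hΔW hb)
          (hRU _ ((memRr b).2 (hΔD hbΔ))) (hopt _ (hΔswap b hbΔ))
        refine le_trans (le_of_eq (sum_congr rfl fun i hi => ?_)) this
        have h0 : ind (U i) (Sum.inl b) = 0 :=
          if_neg (hRU' _ ((memRr b).2 (hΔD hbΔ)) i hi)
        rw [h0, sub_zero]
      · simp at hb)
    (by
      rintro (c | c) hc (b | b) hb
      · simp at hc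
      · simp at hc
      · have hcM := inr_mem_negOf.1 hc
        have hcR := (memRl c).2 (hM₀A (hM hcM))
        refine double_removal_swap U W S (x := Sum.inl c) (hMinl c hcM) (hQW hb) (hMW hc)
          (by simp) (hRU _ hcR) (hRU' _ hcR) (hopt _ ?_)
        exact hW.swap (hpc _ _ b c (hQP (hQ (inl_mem_posOf.1 hb))) (by simp) (by simp)) (by simp)
      · simp at hb)
    (by
      rintro (c | c) hc (b | b) hb
      · simp at hc
      · simp at hc
      · have hcM := inr_mem_negOf.1 hc
        have hbΔ := inl_mem_posOf.1 hb
        have hcA := hM₀A (hM hcM)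
        have hcR := (memRl c).2 hcA
        have hbR := (memRr b).2 (hΔD hbΔ)
        have hbc : b ≠ c := by
          rintro rfl
          exact hADs _ (hΔD hbΔ) hcA
        refine double_swap U W S (x := Sum.inl c) (x' := Sum.inr b) (hMinl c hcM)
          (hswapne _ (hΔW hb)) (by simp) (hΔW hb) (hMW hc) (by simp) (hRU _ hcR) (hRU _ hbR)
          (hRU' _ hbR) (hRU' _ hcR) (hopt _ ?_)
        exact hW.swap (hpc _ _ b c (hΔP hbΔ) (by simp) (by simp))
          (by simp [hbc, hbc.symm])
      · simp at hb)
  have hQR : Disjoint (posOf Q) R := by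
    rw [Finset.disjoint_left]
    rintro (b | b) hb hbR
    · exact Finset.disjoint_left.1 hQA (hQ (inl_mem_posOf.1 hb)) ((memRl b).1 hbR)
    · simp at hb
  have h2 := sum_double_lower hS (fun i => util A D i W) (fun i => (U i ∩ posOf Q).card)
    t Δ.card r hv (hquota _ hQW hQR)
  rw [card_posOf, card_posOf, hQc, hn] at h1
  exact sub_half_le_of_double hs hsn (by linarith) (Nat.cast_nonneg t) (Nat.cast_nonneg Δ.card)
    (Nat.cast_nonneg r) (by linarith) hℓ' (h2.trans h1) hb
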